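/- arXiv:2003.04971 — 3 statements merged into one kernel-verified Lean document; each statement's English description precedes it below -/
import Mathlib

section
/- Assume additionally that B_U is a relatively open convex subset of an affine subspace u* + U_L ⊆ U, where U_L is a closed linear subspace of U, and that K : B_Z × B_U → W is Fréchet differentiable (with respect to directions in Z × U_L). Then the solution map u ∈ B_U ↦ z(u) ∈ Z (where z(u) ∈ B_Z is the unique solution of A z = K(z,u)) is Fréchet differentiable, and for every d ∈ U_L the derivative δz_d := Dz(u)d is the unique solution of the linear equation A δz_d = D_z K(z(u), u) δz_d + D_u K(z(u), u) d. -/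
open Asymptotics Topology

/-- **Differentiability of the fixed point with respect to the parameter (Theorem 3.5 b)).**
In the setting of the parametric fixed point theorem, assume in addition that `B_U` is a
relatively open convex subset of the affine subspace `u₀ + U_L` (with `U_L ⊆ U` a closed linear
subspace) and that `K` is Fréchet differentiable on `B_Z × B_U` (in directions of `Z × U_L`),
with partial derivatives `DzK`, `DuK` bounded by the Lipschitz constants. Then the solution map
`u ∈ B_U ↦ z(u)` is Fréchet differentiable (in directions `d ∈ U_L`), and the derivative
`δz_d = Dz(u)d` is the unique solution of `A δz_d = D_z K(z(u),u) δz_d + D_u K(z(u),u) d`. -/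
theorem stmt_1
    {U W Z : Type*}
    [NormedAddCommGroup U] [NormedSpace ℝ U] [CompleteSpace U]
    [NormedAddCommGroup W] [NormedSpace ℝ W] [CompleteSpace W]
    [NormedAddCommGroup Z] [NormedSpace ℝ Z] [CompleteSpace Z]
    (A : Z ≃L[ℝ] W)
    (B_Z : Set Z) (B_U : Set U)
    (hBZclosed : IsClosed B_Z) (hBZconv : Convex ℝ B_Z) (hBZne : B_Z.Nonempty)
    (hBUne : B_U.Nonempty)
    (K : Z → U → W) (L_z L_u : ℝ) (hLz : 0 ≤ L_z) (hLu : 0 ≤ L_u)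
    (hKlip : ∀ z ∈ B_Z, ∀ u ∈ B_U, ∀ z' ∈ B_Z, ∀ u' ∈ B_U,
      ‖K z u - K z' u'‖ ≤ L_z * ‖z - z'‖ + L_u * ‖u - u'‖)
    (hinv : ∀ z ∈ B_Z, ∀ u ∈ B_U, A.symm (K z u) ∈ B_Z)
    (hcontr : ‖(A.symm : W →L[ℝ] Z)‖ * L_z < 1)
    -- `B_U` is a relatively open convex subset of `u₀ + U_L`, `U_L` a closed subspace:
    (u₀ : U) (U_L : Submodule ℝ U) (hUL : IsClosed (U_L : Set U))
    (hBUaff : ∀ u ∈ B_U, u - u₀ ∈ U_L)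
    (hBUconv : Convex ℝ B_U)
    (hBUopen : ∀ u ∈ B_U, ∃ ε > 0, ∀ d ∈ U_L, ‖d‖ < ε → u + d ∈ B_U)
    -- `K` is Fréchet differentiable on `B_Z × B_U` with partial derivatives `DzK`, `DuK`:
    (DzK : Z → U → (Z →L[ℝ] W)) (DuK : Z → U → (U →L[ℝ] W))
    (hKdiff : ∀ z ∈ B_Z, ∀ u ∈ B_U,
      (fun p : Z × U => K p.1 p.2 - K z u - DzK z u (p.1 - z) - DuK z u (p.2 - u))
        =o[𝓝[B_Z ×ˢ B_U] (z, u)] fun p : Z × U => ‖p.1 - z‖ + ‖p.2 - u‖)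
    (hDzKbound : ∀ z ∈ B_Z, ∀ u ∈ B_U, ∀ w : Z, ‖DzK z u w‖ ≤ L_z * ‖w‖)
    (hDuKbound : ∀ z ∈ B_Z, ∀ u ∈ B_U, ∀ d ∈ U_L, ‖DuK z u d‖ ≤ L_u * ‖d‖)
    -- `sol` is the solution map `u ↦ z(u)` of `A z = K(z,u)`:
    (sol : U → Z)
    (hsol : ∀ u ∈ B_U, sol u ∈ B_Z ∧ A (sol u) = K (sol u) u) :
    ∀ u ∈ B_U, ∃ D : U_L →L[ℝ] Z,
      (∀ d : U_L,
        A (D d) = DzK (sol u) u (D d) + DuK (sol u) u (d : U) ∧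
        ∀ w : Z, A w = DzK (sol u) u w + DuK (sol u) u (d : U) → w = D d) ∧
      (fun d : U_L => sol (u + (d : U)) - sol u - D d)
        =o[𝓝[{d : U_L | u + (d : U) ∈ B_U}] 0] fun d : U_L => ‖d‖ := by
  intro u hu
  obtain ⟨hzu, hAu⟩ := hsol u hu
  set z := sol u
  set M := ‖(A.symm : W →L[ℝ] Z)‖
  have hM0 : 0 ≤ M := norm_nonneg _
  set T : Z →L[ℝ] Z := (A.symm : W →L[ℝ] Z).comp (DzK z u)
  have hTnorm : ‖T‖ < 1 :=
    calc ‖T‖ ≤ M * ‖DzK z u‖ := ContinuousLinearMap.opNorm_comp_le _ _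
      _ ≤ M * L_z := by
        gcongr
        exact ContinuousLinearMap.opNorm_le_bound _ hLz (hDzKbound z hzu u hu)
      _ < 1 := hcontr
  set S : Z →L[ℝ] Z := ↑(Units.oneSub T hTnorm)⁻¹
  have hST (x : Z) : S (x - T x) = x :=
    congrArg (fun f : Z →L[ℝ] Z => f x) (Units.oneSub T hTnorm).inv_mul
  have hTS (x : Z) : S x - T (S x) = x :=
    congrArg (fun f : Z →L[ℝ] Z => f x) (Units.oneSub T hTnorm).mul_inv
  have hAT (x : Z) : A (T x) = DzK z u x := A.apply_symm_apply _
  have heq (x : Z) (w : W) (h : A x = DzK z u x + w) : x = S (A.symm w) := by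
    have hx : x - T x = A.symm w := by
      apply A.injective
      rw [map_sub, hAT, h, A.apply_symm_apply, add_sub_cancel_left]
    rw [← hx, hST]
  have hsolve (w : W) : A (S (A.symm w)) = DzK z u (S (A.symm w)) + w := by
    have h := congrArg A (hTS (A.symm w))
    rw [map_sub, hAT, A.apply_symm_apply] at h
    exact eq_add_of_sub_eq' h
  refine ⟨(S.comp (A.symm : W →L[ℝ] Z)).comp ((DuK z u).comp U_L.subtypeL), fun d =>
    ⟨hsolve _, fun w hw => heq _ _ hw⟩, ?_⟩
  set l := 𝓝[{d : U_L | u + (d : U) ∈ B_U}] (0 : U_L)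
  have hmem : ∀ᶠ d : U_L in l, u + (d : U) ∈ B_U := self_mem_nhdsWithin
  have hlip : (fun d : U_L => sol (u + (d : U)) - z) =O[l] fun d : U_L => ‖d‖ := by
    refine IsBigO.of_bound (M * L_u / (1 - M * L_z)) (hmem.mono fun d hd => ?_)
    obtain ⟨h₁, h₂⟩ := hsol _ hd
    have hK := hKlip _ h₁ _ hd _ hzu _ hu
    rw [← h₂, ← hAu, ← map_sub, add_sub_cancel_left] at hK
    have hA : ‖sol (u + (d : U)) - z‖ ≤ M * ‖A (sol (u + (d : U)) - z)‖ := by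
      simpa using (A.symm : W →L[ℝ] Z).le_opNorm (A (sol (u + (d : U)) - z))
    have hd' : ‖(d : U)‖ = ‖d‖ := rfl
    rw [norm_norm, div_mul_eq_mul_div, le_div_iff₀ (sub_pos.2 hcontr), ← hd']
    nlinarith [mul_le_mul_of_nonneg_left hK hM0]
  have hd0 : Filter.Tendsto (fun d : U_L => ‖d‖) l (𝓝 0) :=
    tendsto_norm_zero.mono_left nhdsWithin_le_nhds
  have htend : Filter.Tendsto (fun d : U_L => (sol (u + (d : U)), u + (d : U))) l
      (𝓝[B_Z ×ˢ B_U] (z, u)) := by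
    refine tendsto_nhdsWithin_iff.2 ⟨.prodMk_nhds ?_ ?_, hmem.mono fun d hd => ⟨(hsol _ hd).1, hd⟩⟩
    · exact tendsto_sub_nhds_zero_iff.1 (hlip.trans_tendsto hd0)
    · have hc : Continuous fun d : U_L => u + (d : U) := by fun_prop
      simpa using (hc.tendsto 0).mono_left (nhdsWithin_le_nhds (s := {d : U_L | u + (d : U) ∈ B_U}))
  have hrem := ((hKdiff z hzu u hu).comp_tendsto htend).trans_isBigO
    (hlip.norm_left.add ((isBigO_refl (fun d : U_L => ‖d‖) l).congr_left fun d => by simp))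
  refine (((S.comp (A.symm : W →L[ℝ] Z)).isBigO_comp _ l).trans_isLittleO hrem).congr'
    (hmem.mono fun d hd => ?_) .rfl
  have hsd := heq (sol (u + (d : U)) - z) (A (sol (u + (d : U)) - z) -
    DzK z u (sol (u + (d : U)) - z)) (by abel)
  have hA' : A (sol (u + (d : U)) - z) = K (sol (u + (d : U))) (u + (d : U)) - K z u := by
    rw [map_sub, (hsol _ hd).2, hAu]
  rw [hA'] at hsd
  simp only [Function.comp_apply, ContinuousLinearMap.comp_apply, add_sub_cancel_left,
    Submodule.subtypeL_apply, ContinuousLinearEquiv.coe_coe]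
  rw [map_sub A.symm, map_sub S, ← hsd]
end

section
/- Let h : ℝⁿ → ℝ be twice continuously differentiable with bounded first and second derivatives, let σ > 0 and let φ ∈ C¹_c(ℝ^{n+1}; ℝ^{n+1}). Then ∫_{ℝⁿ} σ · div(∇h/√(1+|∇h|²))(x) · (−∇h(x), 1)ᵀ φ(x, h(x)) dx = ∫_{ℝⁿ} σ · ((∇h(x)ᵀ, −1)/√(1+|∇h(x)|²)) · (Dφ(x,h(x)) − div(φ)(x,h(x)) · I) · (∇h(x), −1)ᵀ dx, where Dφ denotes the Jacobian matrix of φ and I the (n+1)×(n+1) identity matrix. -/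
open MeasureTheory
open scoped RealInnerProductSpace

theorem ContinuousLinearMap.sum_apply_single_mul {n : ℕ} (L : EuclideanSpace ℝ (Fin n) →L[ℝ] ℝ)
    (v : EuclideanSpace ℝ (Fin n)) :
    ∑ i, L (EuclideanSpace.single i 1) * v i = L v := by
  have hv := (EuclideanSpace.basisFun (Fin n) ℝ).sum_repr v
  conv_rhs => rw [← hv]
  simp [map_sum, mul_comm]

/-- Leibniz rule for the divergence of a scalar multiple of a vector field. -/
theorem sum_fderiv_smul_single {n : ℕ} {f : EuclideanSpace ℝ (Fin n) → ℝ}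
    {V : EuclideanSpace ℝ (Fin n) → EuclideanSpace ℝ (Fin n)} {x : EuclideanSpace ℝ (Fin n)}
    (hf : DifferentiableAt ℝ f x) (hV : DifferentiableAt ℝ V x) :
    ∑ i, fderiv ℝ (fun y => f y • V y) x (EuclideanSpace.single i 1) i =
      f x * ∑ i, fderiv ℝ V x (EuclideanSpace.single i 1) i + fderiv ℝ f x (V x) := by
  rw [fderiv_fun_smul hf hV, ← ContinuousLinearMap.sum_apply_single_mul (fderiv ℝ f x),
    Finset.mul_sum, ← Finset.sum_add_distrib]
  simp

theorem integral_fderiv_apply_eq_zero {E : Type*} [NormedAddCommGroup E] [NormedSpace ℝ E]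
    [MeasurableSpace E] [BorelSpace E] [FiniteDimensional ℝ E] {μ : Measure E}
    [μ.IsAddHaarMeasure] {f : E → ℝ} (hf : ContDiff ℝ 1 f) (hfc : HasCompactSupport f) (v : E) :
    ∫ x, fderiv ℝ f x v ∂μ = 0 := by
  have hint : Integrable (fun x => fderiv ℝ f x v) μ :=
    ((hf.continuous_fderiv one_ne_zero).clm_apply continuous_const).integrable_of_hasCompactSupport
      (hfc.fderiv_apply ℝ v)
  have := integral_mul_fderiv_eq_neg_fderiv_mul_of_integrable (μ := μ) (v := v)
    (f := fun _ : E => (1 : ℝ)) (g := f) (by simp) (by simpa using hint)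
    (by simpa using hf.continuous.integrable_of_hasCompactSupport hfc)
    (fun _ _ => differentiableAt_const _) (fun x _ => hf.differentiable one_ne_zero x)
  simpa using this

/-- The divergence of a compactly supported `C¹` vector field is integrable. -/
theorem integrable_sum_fderiv_single {n : ℕ}
    {V : EuclideanSpace ℝ (Fin n) → EuclideanSpace ℝ (Fin n)}
    (hV : ContDiff ℝ 1 V) (hVc : HasCompactSupport V) :
    Integrable fun x => ∑ i, fderiv ℝ V x (EuclideanSpace.single i 1) i := by
  refine integrable_finsetSum _ fun i _ => ?_
  have hcont : Continuous fun x => fderiv ℝ V x (EuclideanSpace.single i 1) :=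
    (hV.continuous_fderiv one_ne_zero).clm_apply continuous_const
  exact ((EuclideanSpace.proj i : EuclideanSpace ℝ (Fin n) →L[ℝ] ℝ).continuous.comp
    hcont).integrable_of_hasCompactSupport
      ((hVc.fderiv_apply ℝ _).comp_left (g := fun v : EuclideanSpace ℝ (Fin n) => v i) (by simp))

/-- The divergence of a compactly supported `C¹` vector field integrates to zero. -/
theorem integral_sum_fderiv_single_eq_zero {n : ℕ}
    {V : EuclideanSpace ℝ (Fin n) → EuclideanSpace ℝ (Fin n)}
    (hV : ContDiff ℝ 1 V) (hVc : HasCompactSupport V) :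
    ∫ x, ∑ i, fderiv ℝ V x (EuclideanSpace.single i 1) i = 0 := by
  have hcoord : ∀ x i, fderiv ℝ V x (EuclideanSpace.single i 1) i =
      fderiv ℝ (fun y => V y i) x (EuclideanSpace.single i 1) := fun x i => by
    have := ((EuclideanSpace.proj i : EuclideanSpace ℝ (Fin n) →L[ℝ] ℝ).hasFDerivAt.comp x
      (hV.differentiable one_ne_zero x).hasFDerivAt).fderiv
    exact (DFunLike.congr_fun this (EuclideanSpace.single i 1)).symm
  have hVi : ∀ i, ContDiff ℝ 1 fun y => V y i := fun i =>
    (EuclideanSpace.proj i : EuclideanSpace ℝ (Fin n) →L[ℝ] ℝ).contDiff.comp hV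
  have hVic : ∀ i, HasCompactSupport fun y => V y i := fun i =>
    hVc.comp_left (g := fun v : EuclideanSpace ℝ (Fin n) => v i) (by simp)
  simp_rw [hcoord]
  rw [integral_finsetSum]
  · exact Finset.sum_eq_zero fun i _ => integral_fderiv_apply_eq_zero (hVi i) (hVic i) _
  · exact fun i _ => (((hVi i).continuous_fderiv one_ne_zero).clm_apply
      continuous_const).integrable_of_hasCompactSupport ((hVic i).fderiv_apply ℝ _)

section Gradient

variable {E : Type*} [NormedAddCommGroup E] [InnerProductSpace ℝ E] [CompleteSpace E]

theorem ContDiff.gradient {h : E → ℝ} {m k : WithTop ℕ∞} (hh : ContDiff ℝ k h) (hmk : m + 1 ≤ k) :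
    ContDiff ℝ m (gradient h) :=
  (InnerProductSpace.toDual ℝ E).symm.contDiff.comp (hh.fderiv_right hmk)

/-- The Hessian of a `C²` function is symmetric. -/
theorem inner_fderiv_gradient_comm {h : E → ℝ} (hh : ContDiff ℝ 2 h) (x u v : E) :
    ⟪fderiv ℝ (gradient h) x u, v⟫ = ⟪fderiv ℝ (gradient h) x v, u⟫ := by
  have hd : DifferentiableAt ℝ (fderiv ℝ h) x :=
    (hh.fderiv_right (m := 1) (by norm_num)).differentiable one_ne_zero x
  have key : ∀ u v, ⟪fderiv ℝ (gradient h) x u, v⟫ = fderiv ℝ (fderiv ℝ h) x u v := fun u v => by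
    have := ((InnerProductSpace.toDual ℝ E).symm.toContinuousLinearEquiv.hasFDerivAt.comp x
      hd.hasFDerivAt).fderiv
    have h2 : fderiv ℝ (_root_.gradient h) x u =
      (InnerProductSpace.toDual ℝ E).symm (fderiv ℝ (fderiv ℝ h) x u) :=
        DFunLike.congr_fun this u
    rw [h2, InnerProductSpace.toDual_symm_apply]
  rw [key, key]
  exact (hh.contDiffAt.isSymmSndFDerivAt (by simp)).eq u v

end Gradient

theorem fderiv_comp_graph_apply {E F : Type*} [NormedAddCommGroup E] [NormedSpace ℝ E]
    [NormedAddCommGroup F] [NormedSpace ℝ F] {φ : E × ℝ → F} {h : E → ℝ} {x : E}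
    (hφ : DifferentiableAt ℝ φ (x, h x)) (hh : DifferentiableAt ℝ h x) (v : E) :
    fderiv ℝ (fun y => φ (y, h y)) x v =
      fderiv ℝ φ (x, h x) (v, 0) + fderiv ℝ h x v • fderiv ℝ φ (x, h x) (0, 1) := by
  have hg : HasFDerivAt (fun y => (y, h y)) ((ContinuousLinearMap.id ℝ E).prod (fderiv ℝ h x)) x :=
    (hasFDerivAt_id x).prodMk hh.hasFDerivAt
  have hc : HasFDerivAt (fun y => φ (y, h y)) _ x := HasFDerivAt.comp x hφ.hasFDerivAt hg
  rw [hc.fderiv, ← map_smul, ← map_add]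
  simp

theorem HasCompactSupport.comp_graph {E F : Type*} [TopologicalSpace E] [R1Space E] [Zero F]
    {φ : E × ℝ → F} (hφ : HasCompactSupport φ) (h : E → ℝ) :
    HasCompactSupport fun x => φ (x, h x) := by
  refine HasCompactSupport.intro (hφ.isCompact.image continuous_fst) fun x hx => ?_
  by_contra hne
  exact hx ⟨(x, h x), subset_tsupport φ hne, rfl⟩

/-- The derivative of `√(1 + |V|²)`. -/
theorem fderiv_sqrt_one_add_norm_sq_apply {E F : Type*} [NormedAddCommGroup E] [NormedSpace ℝ E]
    [NormedAddCommGroup F] [InnerProductSpace ℝ F] {V : E → F} {x : E}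
    (hV : DifferentiableAt ℝ V x) (v : E) :
    fderiv ℝ (fun y => Real.sqrt (1 + ‖V y‖ ^ 2)) x v =
      (Real.sqrt (1 + ‖V x‖ ^ 2))⁻¹ * ⟪V x, fderiv ℝ V x v⟫ := by
  have h1 := (hV.hasFDerivAt.norm_sq.const_add 1).sqrt (by positivity)
  rw [h1.fderiv]
  simp
  field_simp

/-- For a `C²` function `h` and a `C¹` field `φ`, the difference of the integrands in the weak form of
the mean curvature operator is a divergence. -/
theorem sum_fderiv_tangential_eq {n : ℕ} {h : EuclideanSpace ℝ (Fin n) → ℝ}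
    (hh : ContDiff ℝ 2 h) {φ : EuclideanSpace ℝ (Fin n) × ℝ → EuclideanSpace ℝ (Fin n) × ℝ}
    (hφ : ContDiff ℝ 1 φ) (x : EuclideanSpace ℝ (Fin n)) :
    ∑ i : Fin n, fderiv ℝ (fun y =>
        (⟪(φ (y, h y)).1, -gradient h y⟫ + (φ (y, h y)).2) •
            ((Real.sqrt (1 + ‖gradient h y‖ ^ 2))⁻¹ • gradient h y) +
          Real.sqrt (1 + ‖gradient h y‖ ^ 2) • (φ (y, h y)).1) x (EuclideanSpace.single i 1) i =
      (∑ i : Fin n,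
          fderiv ℝ (fun y => (Real.sqrt (1 + ‖gradient h y‖ ^ 2))⁻¹ • gradient h y) x
            (EuclideanSpace.single i 1) i) *
        (⟪(φ (x, h x)).1, -gradient h x⟫ + (φ (x, h x)).2) -
      (Real.sqrt (1 + ‖gradient h x‖ ^ 2))⁻¹ *
          ((⟪(fderiv ℝ φ (x, h x) (gradient h x, (-1 : ℝ))).1, gradient h x⟫
              - (fderiv ℝ φ (x, h x) (gradient h x, (-1 : ℝ))).2)
            - ((∑ i : Fin n, (fderiv ℝ φ (x, h x) (EuclideanSpace.single i 1, (0 : ℝ))).1 i)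
                + (fderiv ℝ φ (x, h x) ((0 : EuclideanSpace ℝ (Fin n)), (1 : ℝ))).2)
              * (‖gradient h x‖ ^ 2 + 1)) := by
  have hp : DifferentiableAt ℝ (gradient h) x :=
    (hh.gradient (m := 1) (by norm_num)).differentiable one_ne_zero x
  have hhd : DifferentiableAt ℝ h x := hh.differentiable two_ne_zero x
  have hφd : DifferentiableAt ℝ φ (x, h x) := hφ.differentiable one_ne_zero _
  have hΦ : DifferentiableAt ℝ (fun y => φ (y, h y)) x :=
    DifferentiableAt.comp x hφd (differentiableAt_id.prodMk hhd)
  have hW : DifferentiableAt ℝ (fun y => Real.sqrt (1 + ‖gradient h y‖ ^ 2)) x :=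
    ((hp.norm_sq ℝ).const_add 1).sqrt (by positivity)
  have hw : DifferentiableAt ℝ (fun y => (Real.sqrt (1 + ‖gradient h y‖ ^ 2))⁻¹) x :=
    hW.inv (by positivity)
  have hin : DifferentiableAt ℝ (fun y => ⟪(φ (y, h y)).1, -gradient h y⟫) x :=
    hΦ.fst.inner ℝ hp.neg
  have hneg : DifferentiableAt ℝ (fun y => -gradient h y) x := hp.neg
  have hg : DifferentiableAt ℝ (fun y => ⟪(φ (y, h y)).1, -gradient h y⟫ + (φ (y, h y)).2) x :=
    hin.add hΦ.snd
  have hwp : DifferentiableAt ℝ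
      (fun y => (Real.sqrt (1 + ‖gradient h y‖ ^ 2))⁻¹ • gradient h y) x := hw.smul hp
  have hgrad : ∀ v, fderiv ℝ h x v = ⟪gradient h x, v⟫ := fun v => by
    rw [← toDual_gradient, InnerProductSpace.toDual_apply_apply]
  have hΦv : ∀ v, fderiv ℝ (fun y => φ (y, h y)) x v = fderiv ℝ φ (x, h x) (v, 0) +
      ⟪gradient h x, v⟫ • fderiv ℝ φ (x, h x) (0, 1) := fun v => by
    rw [fderiv_comp_graph_apply hφd hhd, hgrad]
  have hΦ1 : ∀ v, fderiv ℝ (fun y => (φ (y, h y)).1) x v =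
      (fderiv ℝ φ (x, h x) (v, 0)).1 + ⟪gradient h x, v⟫ • (fderiv ℝ φ (x, h x) (0, 1)).1 :=
    fun v => by rw [fderiv.fst hΦ]; simp [hΦv]
  have hΦ2 : ∀ v, fderiv ℝ (fun y => (φ (y, h y)).2) x v =
      (fderiv ℝ φ (x, h x) (v, 0)).2 + ⟪gradient h x, v⟫ * (fderiv ℝ φ (x, h x) (0, 1)).2 :=
    fun v => by rw [fderiv.snd hΦ]; simp [hΦv]
  have hdiv : ∑ i : Fin n, fderiv ℝ (fun y => (φ (y, h y)).1) x (EuclideanSpace.single i 1) i =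
      (∑ i : Fin n, (fderiv ℝ φ (x, h x) (EuclideanSpace.single i 1, (0 : ℝ))).1 i) +
        ⟪gradient h x, (fderiv ℝ φ (x, h x) (0, 1)).1⟫ := by
    have := ContinuousLinearMap.sum_apply_single_mul (innerSL ℝ (gradient h x))
      (fderiv ℝ φ (x, h x) (0, 1)).1
    simp only [innerSL_apply_apply] at this
    simp only [hΦ1, PiLp.add_apply, PiLp.smul_apply, smul_eq_mul, Finset.sum_add_distrib, this]
  have hν : fderiv ℝ φ (x, h x) (gradient h x, (-1 : ℝ)) =
      fderiv ℝ φ (x, h x) (gradient h x, 0) - fderiv ℝ φ (x, h x) (0, 1) := by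
    rw [← map_sub]; simp
  have hDg : ∀ v, fderiv ℝ (fun y => ⟪(φ (y, h y)).1, -gradient h y⟫ + (φ (y, h y)).2) x v =
      -⟪(φ (x, h x)).1, fderiv ℝ (gradient h) x v⟫
        - ⟪fderiv ℝ (fun y => (φ (y, h y)).1) x v, gradient h x⟫
        + fderiv ℝ (fun y => (φ (y, h y)).2) x v := fun v => by
    rw [fderiv_fun_add hin hΦ.snd, _root_.add_apply,
      fderiv_inner_apply ℝ hΦ.fst hneg, fderiv_fun_neg]
    simp [sub_eq_add_neg]
  have hsum : ∀ i : Fin n, fderiv ℝ (fun y =>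
        (⟪(φ (y, h y)).1, -gradient h y⟫ + (φ (y, h y)).2) •
            ((Real.sqrt (1 + ‖gradient h y‖ ^ 2))⁻¹ • gradient h y) +
          Real.sqrt (1 + ‖gradient h y‖ ^ 2) • (φ (y, h y)).1) x (EuclideanSpace.single i 1) i =
      fderiv ℝ (fun y => (⟪(φ (y, h y)).1, -gradient h y⟫ + (φ (y, h y)).2) •
            ((Real.sqrt (1 + ‖gradient h y‖ ^ 2))⁻¹ • gradient h y)) x
              (EuclideanSpace.single i 1) i +
      fderiv ℝ (fun y => Real.sqrt (1 + ‖gradient h y‖ ^ 2) • (φ (y, h y)).1) x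
        (EuclideanSpace.single i 1) i := fun i => by
    rw [fderiv_fun_add (hg.fun_smul hwp) (hW.fun_smul hΦ.fst)]
    rfl
  rw [Finset.sum_congr rfl fun i _ => hsum i, Finset.sum_add_distrib,
    sum_fderiv_smul_single hg hwp, sum_fderiv_smul_single hW hΦ.fst, hdiv,
    fderiv_sqrt_one_add_norm_sq_apply hp, hDg, hΦ1, hΦ2, hν]
  have hsymm := inner_fderiv_gradient_comm hh x (gradient h x) (φ (x, h x)).1
  rw [real_inner_comm] at hsymm
  have hW2 : Real.sqrt (1 + ‖gradient h x‖ ^ 2) =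
      (Real.sqrt (1 + ‖gradient h x‖ ^ 2))⁻¹ * (1 + ‖gradient h x‖ ^ 2) := by
    have hpos : 0 < Real.sqrt (1 + ‖gradient h x‖ ^ 2) := by positivity
    rw [eq_inv_mul_iff_mul_eq₀ hpos.ne', Real.mul_self_sqrt (by positivity)]
  have hcomm := real_inner_comm (gradient h x) (fderiv ℝ φ (x, h x) (0, 1)).1
  have hcomm2 := real_inner_comm (gradient h x) (fderiv ℝ (gradient h) x (φ (x, h x)).1)
  generalize hwdef : (Real.sqrt (1 + ‖gradient h x‖ ^ 2))⁻¹ = w at *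
  have hwφ : fderiv ℝ φ (x, h x) (w • gradient h x, 0) =
      w • fderiv ℝ φ (x, h x) (gradient h x, 0) := by
    rw [← map_smul]; simp
  rw [hW2]
  simp only [hwφ, map_smul, Prod.smul_fst, Prod.smul_snd, Prod.fst_sub, Prod.snd_sub, inner_smul_left,
    inner_smul_right, inner_add_left, inner_sub_left, inner_neg_right, smul_eq_mul, hsymm,
    real_inner_self_eq_norm_sq, ← hcomm, ← hcomm2]
  simp
  ring

/-- **Weak form of the surface tension term (equation (3.27) / `surface`).**
For `h : ℝⁿ → ℝ` twice continuously differentiable with bounded first and second derivatives,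
`σ > 0` and `φ ∈ C¹_c(ℝ^{n+1}; ℝ^{n+1})`,
`∫ σ div(∇h/√(1+|∇h|²)) (−∇h, 1)ᵀ φ(x,h(x)) dx
  = ∫ σ ((∇h, −1)ᵀ/√(1+|∇h|²)) (Dφ − div(φ) I) (∇h, −1) dx`,
where `Dφ` is the Jacobian of `φ` and pairs `(v, c) ∈ ℝⁿ × ℝ` model vectors of `ℝ^{n+1}`. -/
theorem stmt_6 (n : ℕ) (σ : ℝ) (hσ : 0 < σ)
    (h : EuclideanSpace ℝ (Fin n) → ℝ) (hh : ContDiff ℝ 2 h)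
    (hbd : ∃ C : ℝ, ∀ x, ‖fderiv ℝ h x‖ ≤ C ∧ ‖fderiv ℝ (fun y => fderiv ℝ h y) x‖ ≤ C)
    (φ : EuclideanSpace ℝ (Fin n) × ℝ → EuclideanSpace ℝ (Fin n) × ℝ)
    (hφ : ContDiff ℝ 1 φ) (hφc : HasCompactSupport φ) :
    (∫ x, σ *
        (∑ i : Fin n,
          fderiv ℝ (fun y => (Real.sqrt (1 + ‖gradient h y‖ ^ 2))⁻¹ • gradient h y) x
            (EuclideanSpace.single i 1) i) *
        (⟪(φ (x, h x)).1, -gradient h x⟫ + (φ (x, h x)).2))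
      = ∫ x, σ * (Real.sqrt (1 + ‖gradient h x‖ ^ 2))⁻¹ *
          ((⟪(fderiv ℝ φ (x, h x) (gradient h x, (-1 : ℝ))).1, gradient h x⟫
              - (fderiv ℝ φ (x, h x) (gradient h x, (-1 : ℝ))).2)
            - ((∑ i : Fin n, (fderiv ℝ φ (x, h x) (EuclideanSpace.single i 1, (0 : ℝ))).1 i)
                + (fderiv ℝ φ (x, h x) ((0 : EuclideanSpace ℝ (Fin n)), (1 : ℝ))).2)
              * (‖gradient h x‖ ^ 2 + 1)) := by
  have hp : ContDiff ℝ 1 (gradient h) := hh.gradient (by norm_num)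
  have hΦ : ContDiff ℝ 1 fun x => φ (x, h x) :=
    hφ.comp (contDiff_id.prodMk (hh.of_le one_le_two))
  have hΦc : HasCompactSupport fun x => φ (x, h x) := hφc.comp_graph h
  have hW : ContDiff ℝ 1 fun x => Real.sqrt (1 + ‖gradient h x‖ ^ 2) :=
    (contDiff_const.add (hp.norm_sq ℝ)).sqrt fun x => by positivity
  have hwp : ContDiff ℝ 1 fun x => (Real.sqrt (1 + ‖gradient h x‖ ^ 2))⁻¹ • gradient h x :=
    (hW.inv fun x => by positivity).smul hp
  have hg : ContDiff ℝ 1 fun x => ⟪(φ (x, h x)).1, -gradient h x⟫ + (φ (x, h x)).2 :=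
    (hΦ.fst.inner ℝ hp.neg).add hΦ.snd
  have hgc : HasCompactSupport fun x => ⟪(φ (x, h x)).1, -gradient h x⟫ + (φ (x, h x)).2 :=
    hΦc.mono fun x hx h0 => hx (by simp [show φ (x, h x) = 0 from h0])
  have hV : ContDiff ℝ 1 fun x =>
      (⟪(φ (x, h x)).1, -gradient h x⟫ + (φ (x, h x)).2) •
          ((Real.sqrt (1 + ‖gradient h x‖ ^ 2))⁻¹ • gradient h x) +
        Real.sqrt (1 + ‖gradient h x‖ ^ 2) • (φ (x, h x)).1 :=
    (hg.smul hwp).add (hW.smul hΦ.fst)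
  have hVc : HasCompactSupport fun x =>
      (⟪(φ (x, h x)).1, -gradient h x⟫ + (φ (x, h x)).2) •
          ((Real.sqrt (1 + ‖gradient h x‖ ^ 2))⁻¹ • gradient h x) +
        Real.sqrt (1 + ‖gradient h x‖ ^ 2) • (φ (x, h x)).1 :=
    hΦc.mono fun x hx h0 => hx (by simp [show φ (x, h x) = 0 from h0])
  have hdivc : Continuous fun x => ∑ i : Fin n,
      fderiv ℝ (fun y => (Real.sqrt (1 + ‖gradient h y‖ ^ 2))⁻¹ • gradient h y) x
        (EuclideanSpace.single i 1) i := by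
    refine continuous_finsetSum _ fun i _ => ?_
    exact (EuclideanSpace.proj i : EuclideanSpace ℝ (Fin n) →L[ℝ] ℝ).continuous.comp
      ((hwp.continuous_fderiv one_ne_zero).clm_apply continuous_const)
  have hL := (hdivc.mul hg.continuous).integrable_of_hasCompactSupport (μ := volume) hgc.mul_left
  have hR := integral_sub hL (integrable_sum_fderiv_single hV hVc)
  rw [integral_sum_fderiv_single_eq_zero hV hVc, sub_zero] at hR
  simp only [mul_assoc σ]
  rw [integral_const_mul, integral_const_mul]
  refine congrArg (σ * ·) (hR.symm.trans (integral_congr_ae (ae_of_all _ fun x => ?_)))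
  exact (congrArg (_ - ·) (sum_fderiv_tangential_eq hh hφ x)).trans (sub_sub_cancel _ _)
end

section
/- Let t₀ > 0, d ≥ 1, and let u : [0, t₀] × ℝ^d → ℝ^d be continuous and bounded, and Lipschitz continuous in the space variable uniformly in t. Let (μ_t)_{t ∈ [0,t₀]} and (ν_t)_{t ∈ [0,t₀]} be families of locally finite Borel measures on ℝ^d such that for every compactly supported continuous φ : ℝ^d → ℝ the maps t ↦ ∫ φ dμ_t and t ↦ ∫ φ dν_t are continuous, such that μ₀ = ν₀, and such that both families are distributional solutions of the homogeneous transport equation, i.e. for every continuously differentiable φ : [0, t₀) × ℝ^d → ℝ with compact support, ∫₀^{t₀} ∫_{ℝ^d} ( ∂_t φ(t, z) + u(t, z)·∇_z φ(t, z) ) dμ_t(z) dt + ∫_{ℝ^d} φ(0, z) dμ₀(z) = 0 and the same identity holds with μ replaced by ν. Then μ_t = ν_t for all t ∈ [0, t₀]. -/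
open MeasureTheory
open scoped RealInnerProductSpace

open Set Metric Filter
open scoped NNReal Topology ContDiff Convolution

section Flow

variable {E : Type*} [NormedAddCommGroup E] [InnerProductSpace ℝ E]

/-- `α` is an integral curve of the time-dependent vector field `v` on the time interval
`[a, b]`. -/
def IsFlowLine (v : ℝ → E → E) (a b : ℝ) (α : ℝ → E) : Prop :=
  ∀ s ∈ Icc a b, HasDerivWithinAt α (v s (α s)) (Icc a b) s

variable {v : ℝ → E → E} {a b C : ℝ} {L : ℝ≥0} {α β : ℝ → E}

/-- Through every point passes an integral curve of a bounded Lipschitz vector field. -/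
lemma exists_isFlowLine [CompleteSpace E] (hv : Continuous fun p : ℝ × E => v p.1 p.2)
    (hC : ∀ t z, ‖v t z‖ ≤ C) (hL : ∀ t, LipschitzWith L (v t)) {t : ℝ} (ht : t ∈ Icc a b)
    (z : E) : ∃ α : ℝ → E, α t = z ∧ IsFlowLine v a b α := by
  have hC0 : 0 ≤ C := (norm_nonneg _).trans (hC 0 0)
  have hpl : IsPicardLindelof v (⟨t, ht⟩ : Icc a b) z
      (C.toNNReal * (max (b - t) (t - a)).toNNReal) 0 C.toNNReal L :=
    { lipschitzOnWith := fun s _ => (hL s).lipschitzOnWith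
      continuousOn := fun x _ => (hv.comp (by fun_prop : Continuous fun s => (s, x))).continuousOn
      norm_le := fun s _ x _ => by rw [Real.coe_toNNReal _ hC0]; exact hC s x
      mul_max_le := by
        have : 0 ≤ max (b - t) (t - a) := le_max_of_le_left (by linarith [ht.2])
        simp [Real.coe_toNNReal _ this] }
  exact hpl.exists_eq_forall_mem_Icc_hasDerivWithinAt₀

lemma IsFlowLine.hasDerivAt (hα : IsFlowLine v a b α) {s : ℝ} (hs : s ∈ Ioo a b) :
    HasDerivAt α (v s (α s)) s :=
  (hα s (Ioo_subset_Icc_self hs)).hasDerivAt (Icc_mem_nhds hs.1 hs.2)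

lemma IsFlowLine.continuousOn (hα : IsFlowLine v a b α) : ContinuousOn α (Icc a b) :=
  fun s hs => (hα s hs).continuousWithinAt

/-- Two integral curves separate at most exponentially, forward and backward in time. -/
lemma IsFlowLine.norm_sub_le (hL : ∀ t, LipschitzWith L (v t)) (hα : IsFlowLine v a b α)
    (hβ : IsFlowLine v a b β) {s t : ℝ} (hs : s ∈ Icc a b) (ht : t ∈ Icc a b) :
    ‖α s - β s‖ ≤ Real.exp (L * |s - t|) * ‖α t - β t‖ := by
  have hcont := hα.continuousOn.sub hβ.continuousOn
  have key : ∀ x, |⟪α x - β x, v x (α x) - v x (β x)⟫| ≤ L * ‖α x - β x‖ ^ 2 := fun x => by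
    refine (abs_real_inner_le_norm _ _).trans ?_
    have := (hL x).norm_sub_le (α x) (β x)
    nlinarith [norm_nonneg (α x - β x)]
  have hder : ∀ c : ℝ, ∀ x ∈ Ioo a b, HasDerivAt (fun x => Real.exp (c * x) * ‖α x - β x‖ ^ 2)
      (Real.exp (c * x) * (c * ‖α x - β x‖ ^ 2 + 2 * ⟪α x - β x, v x (α x) - v x (β x)⟫)) x :=
    fun c x hx => by
      have h1 : HasDerivAt (fun x => Real.exp (c * x)) (Real.exp (c * x) * c) x := by
        simpa using ((hasDerivAt_id x).const_mul c).exp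
      refine (h1.mul ((hα.hasDerivAt hx).sub (hβ.hasDerivAt hx)).norm_sq).congr_deriv ?_
      simp only [Pi.sub_apply]
      ring
  have hc : ∀ c : ℝ, ContinuousOn (fun x => Real.exp (c * x) * ‖α x - β x‖ ^ 2) (Icc a b) :=
    fun c => (by fun_prop : Continuous fun x => Real.exp (c * x)).continuousOn.mul
      (hcont.norm.pow 2)
  suffices h : ‖α s - β s‖ ^ 2 ≤ (Real.exp (L * |s - t|) * ‖α t - β t‖) ^ 2 from
    (pow_le_pow_iff_left₀ (norm_nonneg _) (by positivity) two_ne_zero).1 h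
  have hcancel : ∀ c : ℝ, c * (s - t) = -(2 * L * |s - t|) →
      Real.exp (c * s) * ‖α s - β s‖ ^ 2 ≤ Real.exp (c * t) * ‖α t - β t‖ ^ 2 →
      ‖α s - β s‖ ^ 2 ≤ (Real.exp (L * |s - t|) * ‖α t - β t‖) ^ 2 := fun c hcc h => by
    have e1 : Real.exp (c * t) = Real.exp (c * s) * Real.exp (L * |s - t|) ^ 2 := by
      rw [← Real.exp_nat_mul, ← Real.exp_add]
      congr 1
      push_cast
      linarith
    rw [e1, mul_assoc, ← mul_pow] at h
    exact le_of_mul_le_mul_left h (Real.exp_pos _)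
  rcases le_total t s with hts | hst
  · refine hcancel (-(2 * L)) (by rw [abs_of_nonneg (sub_nonneg.2 hts)]; ring) ?_
    refine antitoneOn_of_deriv_nonpos (convex_Icc a b) (hc _) ?_ ?_ ht hs hts
    · rw [interior_Icc]
      exact fun x hx => (hder _ x hx).differentiableAt.differentiableWithinAt
    · rw [interior_Icc]
      intro x hx
      rw [(hder _ x hx).deriv]
      have := (abs_le.1 (key x)).2
      exact mul_nonpos_of_nonneg_of_nonpos (Real.exp_pos _).le (by linarith)
  · refine hcancel (2 * L) (by rw [abs_of_nonpos (sub_nonpos.2 hst)]; ring) ?_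
    refine monotoneOn_of_deriv_nonneg (convex_Icc a b) (hc _) ?_ ?_ hs ht hst
    · rw [interior_Icc]
      exact fun x hx => (hder _ x hx).differentiableAt.differentiableWithinAt
    · rw [interior_Icc]
      intro x hx
      rw [(hder _ x hx).deriv]
      have := (abs_le.1 (key x)).1
      exact mul_nonneg (Real.exp_pos _).le (by linarith)

lemma IsFlowLine.norm_sub_le_mul_abs (hC : ∀ t z, ‖v t z‖ ≤ C) (hα : IsFlowLine v a b α)
    {s t : ℝ} (hs : s ∈ Icc a b) (ht : t ∈ Icc a b) : ‖α s - α t‖ ≤ C * |s - t| :=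
  (convex_Icc a b).norm_image_sub_le_of_norm_hasDerivWithin_le hα (fun x _ => hC x _) ht hs

/-- Transporting a compactly supported Lipschitz function along the flow gives a Lipschitz
function of space-time which is constant along integral curves. The last clause combines
this constancy with the Lipschitz bound. -/
lemma exists_transported [CompleteSpace E] (hv : Continuous fun p : ℝ × E => v p.1 p.2)
    (hC : ∀ t z, ‖v t z‖ ≤ C) (hL : ∀ t, LipschitzWith L (v t)) {T : ℝ} (hT : T ∈ Icc a b)
    {ψ : E → ℝ} {K : ℝ≥0} (hψ : LipschitzWith K ψ) (hψs : HasCompactSupport ψ) :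
    ∃ (f : ℝ × E → ℝ) (R K' : ℝ), 0 ≤ K' ∧ (∀ z, f (T, z) = ψ z) ∧
      (∀ t z, R < ‖z‖ → f (t, z) = 0) ∧
      (∀ s t y z, |f (s, y) - f (t, z)| ≤ K' * (‖y - z‖ + C * |s - t|)) ∧
      ∀ α, IsFlowLine v a b α → ∀ s ∈ Icc a b, ∀ t ∈ Icc a b, ∀ y,
        |f (s, y) - f (t, α t)| ≤ K' * ‖y - α s‖ := by
  have hab : a ≤ b := hT.1.trans hT.2
  have hC0 : 0 ≤ C := (norm_nonneg _).trans (hC 0 0)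
  choose X hX0 hX using fun (t : Icc a b) (z : E) => exists_isFlowLine hv hC hL t.2 z
  set f : ℝ × E → ℝ := fun p => ψ (X (projIcc a b hab p.1) p.2 T) with hf
  have hflow : ∀ α, IsFlowLine v a b α → ∀ s ∈ Icc a b, ∀ t ∈ Icc a b, ∀ y,
        |f (s, y) - f (t, α t)| ≤ (K * Real.exp (L * (b - a))) * ‖y - α s‖ := by
    intro α hα s hs t ht y
    have h1 : X ⟨t, ht⟩ (α t) T = α T := by
      have := (hX ⟨t, ht⟩ (α t)).norm_sub_le hL hα hT ht
      rw [hX0 ⟨t, ht⟩, sub_self, norm_zero, mul_zero] at this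
      exact sub_eq_zero.1 (norm_le_zero_iff.1 this)
    have h2 := (hX ⟨s, hs⟩ y).norm_sub_le hL hα hT hs
    rw [hX0 ⟨s, hs⟩] at h2
    simp only [hf, projIcc_of_mem hab hs, projIcc_of_mem hab ht, h1]
    have h3 := hψ.norm_sub_le (X ⟨s, hs⟩ y T) (α T)
    have h4 : |T - s| ≤ b - a := abs_le.2 ⟨by linarith [hT.1, hs.2], by linarith [hT.2, hs.1]⟩
    rw [Real.norm_eq_abs] at h3
    refine h3.trans ?_
    rw [mul_assoc]
    gcongr
    refine h2.trans ?_
    gcongr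
  obtain ⟨R₀, hR₀⟩ := hψs.isCompact.isBounded.subset_closedBall 0
  refine ⟨f, R₀ + C * (b - a), K * Real.exp (L * (b - a)), by positivity, ?_, ?_, ?_, hflow⟩
  · intro z
    simp only [hf, projIcc_of_mem hab hT, hX0 ⟨T, hT⟩]
  · intro t z hz
    by_contra hne
    have h1 := hR₀ (subset_tsupport _ hne)
    have h2 := (hX (projIcc a b hab t) z).norm_sub_le_mul_abs hC (projIcc a b hab t).2 hT
    rw [hX0] at h2
    set τ := projIcc a b hab t
    have h4 : |(τ : ℝ) - T| ≤ b - a :=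
      abs_le.2 ⟨by linarith [hT.2, τ.2.1], by linarith [hT.1, τ.2.2]⟩
    rw [mem_closedBall_zero_iff] at h1
    have := norm_le_norm_add_norm_sub (X τ z T) z
    have h5 : C * |(τ : ℝ) - T| ≤ C * (b - a) := by gcongr
    rw [norm_sub_rev] at h2
    have := norm_sub_norm_le z (X τ z T)
    rw [norm_sub_rev] at this
    linarith
  · intro s t y z
    set σ := projIcc a b hab s with hσ
    set τ := projIcc a b hab t with hτ
    have e1 : f (s, y) = f (σ, y) := by simp [hf, hσ]
    have e2 : f (t, z) = f (τ, X τ z τ) := by rw [hX0]; simp [hf, hτ]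
    rw [e1, e2]
    refine (hflow _ (hX τ z) σ σ.2 τ τ.2 y).trans ?_
    have h2 := (hX τ z).norm_sub_le_mul_abs hC τ.2 σ.2
    rw [hX0] at h2
    have h3 : |(τ : ℝ) - σ| ≤ |s - t| := by
      rw [abs_sub_comm s t]
      exact abs_projIcc_sub_projIcc hab
    gcongr
    calc ‖y - X τ z σ‖ ≤ ‖y - z‖ + ‖z - X τ z σ‖ := norm_sub_le_norm_sub_add_norm_sub ..
      _ ≤ ‖y - z‖ + C * |s - t| := by gcongr; exact h2.trans (by gcongr)

end Flow

lemma continuous_of_abs_sub_le {E : Type*} [NormedAddCommGroup E] {f : ℝ × E → ℝ} {K C : ℝ}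
    (hf : ∀ s t y z, |f (s, y) - f (t, z)| ≤ K * (‖y - z‖ + C * |s - t|)) : Continuous f := by
  refine continuous_iff_continuousAt.2 fun p => tendsto_iff_dist_tendsto_zero.2 ?_
  refine squeeze_zero (fun _ => dist_nonneg) (fun q => hf q.1 p.1 q.2 p.2) ?_
  have : Continuous fun q : ℝ × E => K * (‖q.2 - p.2‖ + C * |q.1 - p.1|) := by fun_prop
  simpa using this.tendsto p

section Mollify

/-- Mollification at scale `ε`: pointwise bounds on oscillations and on difference quotients
at scale `ε` are inherited by the smooth approximation and its directional derivatives. -/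
lemma exists_contDiff_mollification {F : Type*} [NormedAddCommGroup F] [NormedSpace ℝ F]
    [FiniteDimensional ℝ F] {f : F → ℝ} (hf : Continuous f) {ε : ℝ} (hε : 0 < ε) :
    ∃ g : F → ℝ, ContDiff ℝ ∞ g ∧
      (∀ x δ, (∀ y ∈ ball x ε, |f y - f x| ≤ δ) → |g x - f x| ≤ δ) ∧
      ∀ x w δ, 0 ≤ δ → (∀ y ∈ ball x ε, ∀ h, |h| < ε → |f (y + h • w) - f y| ≤ δ * |h|) →
        |fderiv ℝ g x w| ≤ δ := by
  borelize F
  let m : Measure F := .addHaar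
  let φ : ContDiffBump (0 : F) := ⟨ε / 2, ε, half_pos hε, half_lt_self hε⟩
  set g : F → ℝ := φ.normed m ⋆[ContinuousLinearMap.lsmul ℝ ℝ, m] f with hg
  have hgs : ContDiff ℝ ∞ g := φ.hasCompactSupport_normed.contDiff_convolution_left _
    φ.contDiff_normed hf.locallyIntegrable
  refine ⟨g, hgs, fun x δ h => φ.dist_normed_convolution_le hf.aestronglyMeasurable h, ?_⟩
  intro x w δ hδ hfx
  have hquot : ∀ h : ℝ, |h| < ε → |g (x + h • w) - g x| ≤ δ * |h| := by
    intro h hh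
    let q : F → ℝ := fun y => f (y + h • w) - f y
    have hq : Continuous q := by fun_prop
    have hint : ∀ z, Integrable (fun t => φ.normed m t • f (z - t)) m := fun z =>
      (φ.continuous_normed.smul (by fun_prop)).integrable_of_hasCompactSupport
        φ.hasCompactSupport_normed.smul_right
    have e : (φ.normed m ⋆[ContinuousLinearMap.lsmul ℝ ℝ, m] q) x = g (x + h • w) - g x := by
      simp only [hg, convolution_def, ContinuousLinearMap.lsmul_apply]
      rw [← integral_sub (hint _) (hint _)]
      refine integral_congr_ae (.of_forall fun t => ?_)
      simp only [q, smul_eq_mul, mul_sub]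
      congr 3
      abel
    rw [← e]
    have h1 := dist_convolution_le (f := φ.normed m) (g := q) (x₀ := x) (z₀ := (0 : ℝ))
      (R := φ.rOut) (ε := δ * |h|) (μ := m) (by positivity) φ.support_normed_eq.subset
      φ.nonneg_normed φ.integral_normed hq.aestronglyMeasurable (fun y hy => by
        rw [dist_zero_right, Real.norm_eq_abs]
        exact hfx y hy h hh)
    rwa [dist_zero_right, Real.norm_eq_abs] at h1
  have hd : HasDerivAt (fun h : ℝ => g (x + h • w)) (fderiv ℝ g x w) 0 := by
    have h1 : HasDerivAt (fun h : ℝ => x + h • w) w 0 := by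
      simpa using ((hasDerivAt_id (0 : ℝ)).smul_const w).const_add x
    have h2 : HasFDerivAt g (fderiv ℝ g x) (x + (0 : ℝ) • w) := by
      rw [zero_smul, add_zero]
      exact (hgs.differentiable (by simp)).differentiableAt.hasFDerivAt
    exact h2.comp_hasDerivAt 0 h1
  rw [← hd.deriv, ← Real.norm_eq_abs]
  refine norm_deriv_le_of_lip' hδ ?_
  filter_upwards [Metric.ball_mem_nhds (0 : ℝ) hε] with h hh
  rw [mem_ball_zero_iff, Real.norm_eq_abs] at hh
  simpa using hquot h hh

variable {E : Type*} [NormedAddCommGroup E] [InnerProductSpace ℝ E] [FiniteDimensional ℝ E]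
  {v : ℝ → E → E} {a b C : ℝ} {L : ℝ≥0}

/-- A Lipschitz function transported by the flow is uniformly approximated by smooth functions
which almost solve the transport equation. -/
lemma exists_contDiff_approx (hv : Continuous fun p : ℝ × E => v p.1 p.2)
    (hC : ∀ t z, ‖v t z‖ ≤ C) (hL : ∀ t, LipschitzWith L (v t))
    {f : ℝ × E → ℝ} {R K : ℝ} (hK : 0 ≤ K) (hfR : ∀ t z, R < ‖z‖ → f (t, z) = 0)
    (hfl : ∀ s t y z, |f (s, y) - f (t, z)| ≤ K * (‖y - z‖ + C * |s - t|))
    (hft : ∀ α, IsFlowLine v (a - 1) (b + 1) α → ∀ s ∈ Icc (a - 1) (b + 1),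
      ∀ t ∈ Icc (a - 1) (b + 1), ∀ y, |f (s, y) - f (t, α t)| ≤ K * ‖y - α s‖)
    {δ : ℝ} (hδ : 0 < δ) :
    ∃ g : ℝ × E → ℝ, ContDiff ℝ ∞ g ∧ (∀ t z, |g (t, z) - f (t, z)| ≤ δ) ∧
      (∀ t z, R + 1 < ‖z‖ → g (t, z) = 0) ∧
      ∀ t ∈ Icc a b, ∀ z, |fderiv ℝ g (t, z) (1, v t z)| ≤ δ := by
  have hC0 : 0 ≤ C := (norm_nonneg _).trans (hC 0 0)
  have hfc : Continuous f := continuous_of_abs_sub_le hfl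
  obtain ⟨η, hη, hηv⟩ : ∃ η > 0, ∀ z, ‖z‖ ≤ R + 1 + C → ∀ s ∈ Icc (a - 1) (b + 1),
      ∀ t ∈ Icc (a - 1) (b + 1), |s - t| < η → ‖v s z - v t z‖ ≤ δ / (2 * (K + 1)) := by
    have hcomp : IsCompact (Icc (a - 1) (b + 1) ×ˢ closedBall (0 : E) (R + 1 + C)) :=
      isCompact_Icc.prod (isCompact_closedBall _ _)
    obtain ⟨η, hη, h⟩ := Metric.uniformContinuousOn_iff.1
      (hcomp.uniformContinuousOn_of_continuous hv.continuousOn) (δ / (2 * (K + 1)))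
      (by positivity)
    refine ⟨η, hη, fun z hz s hs t ht hst => ?_⟩
    have := h (s, z) ⟨hs, by simpa using hz⟩ (t, z) ⟨ht, by simpa using hz⟩
      (by simpa [Prod.dist_eq, Real.dist_eq, hη] using hst)
    rw [dist_eq_norm] at this
    exact this.le
  obtain ⟨ε, hε, hε1, hε2, hε3, hε4⟩ : ∃ ε > 0, ε ≤ 1 / 2 ∧ 2 * ε ≤ η ∧
      K * ((1 + C) * ε) ≤ δ ∧ L * ((1 + C) * ε) ≤ δ / (2 * (K + 1)) := by
    have hh : ∀ c d : ℝ, 0 ≤ c → 0 < d → ∀ᶠ ε in 𝓝[>] (0 : ℝ), c * ε ≤ d := fun c d hc hd => by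
      have : Tendsto (fun ε : ℝ => c * ε) (𝓝[>] 0) (𝓝 0) := by
        have : Continuous fun ε : ℝ => c * ε := by fun_prop
        simpa using (this.tendsto 0).mono_left nhdsWithin_le_nhds
      exact (this.eventually (gt_mem_nhds hd)).mono fun _ h => h.le
    obtain ⟨ε, h⟩ := ((((hh 1 (1 / 2) one_pos.le (by norm_num)).and (hh 2 η two_pos.le hη)).and
      ((hh (K * (1 + C)) δ (by positivity) hδ).and (hh (L * (1 + C)) (δ / (2 * (K + 1)))
      (by positivity) (by positivity)))).and self_mem_nhdsWithin).exists
    exact ⟨ε, h.2, by linarith [h.1.1.1], h.1.1.2, by linarith [h.1.2.1], by linarith [h.1.2.2]⟩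
  have hball : ∀ {t s : ℝ} {z y : E}, (s, y) ∈ ball (t, z) ε → |s - t| < ε ∧ ‖y - z‖ < ε :=
    fun h => by simpa [Prod.dist_eq, Real.dist_eq, dist_eq_norm] using h
  obtain ⟨g, hgs, hgf, hgd⟩ := exists_contDiff_mollification hfc hε
  refine ⟨g, hgs, fun t z => hgf _ _ ?_, fun t z hz => ?_, fun t ht z => hgd _ _ _ hδ.le ?_⟩
  · rintro ⟨s, y⟩ hy
    obtain ⟨h1, h2⟩ := hball hy
    refine (hfl s t y z).trans (le_trans ?_ hε3)
    gcongr
    have : C * |s - t| ≤ C * ε := by gcongr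
    linarith
  · have h0 : f (t, z) = 0 := hfR t z (by linarith)
    have := hgf (t, z) 0 ?_
    · rw [h0, sub_zero] at this
      exact abs_nonpos_iff.1 this
    · rintro ⟨s, y⟩ hy
      obtain ⟨h1, h2⟩ := hball hy
      rw [h0, hfR s y, sub_zero, abs_zero]
      have := norm_sub_norm_le z y
      rw [norm_sub_rev] at this
      linarith
  · rintro ⟨s, y⟩ hy h hh
    obtain ⟨h1, h2⟩ := hball hy
    have e : (s, y) + h • ((1 : ℝ), v t z) = (s + h, y + h • v t z) := by simp
    rw [e]
    have hhv : ‖h • v t z‖ ≤ ε * C := by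
      rw [norm_smul, Real.norm_eq_abs]
      gcongr
      exact hC t z
    by_cases hz : R + 1 + C < ‖z‖
    · have h3 := norm_sub_norm_le z y
      rw [norm_sub_rev] at h3
      have h4 := norm_sub_le_norm_add y (h • v t z)
      rw [hfR s y (by linarith), hfR (s + h) _ (by nlinarith), sub_zero, abs_zero]
      positivity
    · rw [not_lt] at hz
      rw [abs_lt] at h1 hh
      have hs : s ∈ Icc (a - 1) (b + 1) := ⟨by linarith [ht.1], by linarith [ht.2]⟩
      have hsh : s + h ∈ Icc (a - 1) (b + 1) := ⟨by linarith [ht.1], by linarith [ht.2]⟩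
      have ht' : t ∈ Icc (a - 1) (b + 1) := ⟨by linarith [ht.1], by linarith [ht.2]⟩
      obtain ⟨α, hαs, hα⟩ := exists_isFlowLine hv hC hL hs y
      have h5 := hft α hα (s + h) hsh s hs (y + h • v t z)
      rw [hαs] at h5
      have hsub : uIcc s (s + h) ⊆ Icc (a - 1) (b + 1) := uIcc_subset_Icc hs hsh
      have h6 : ‖(α (s + h) - (s + h) • v t z) - (α s - s • v t z)‖
          ≤ δ / (K + 1) * ‖(s + h) - s‖ := by
        refine (convex_uIcc s (s + h)).norm_image_sub_le_of_norm_hasDerivWithin_le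
          (f := fun τ => α τ - τ • v t z) (f' := fun τ => v τ (α τ) - v t z) ?_ ?_
          left_mem_uIcc right_mem_uIcc
        · intro τ hτ
          have : HasDerivWithinAt (fun τ : ℝ => τ • v t z) (v t z) (uIcc s (s + h)) τ := by
            simpa using ((hasDerivAt_id τ).smul_const (v t z)).hasDerivWithinAt
          exact ((hα τ (hsub hτ)).mono hsub).sub this
        · intro τ hτ
          have hτs : |τ - s| < ε := (abs_sub_left_of_mem_uIcc hτ).trans_lt (by
            rw [add_sub_cancel_left]; exact abs_lt.2 hh)
          have h7 := hα.norm_sub_le_mul_abs hC (hsub hτ) hs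
          rw [hαs] at h7
          have h8 : ‖α τ - z‖ ≤ (1 + C) * ε := by
            have := norm_sub_le_norm_sub_add_norm_sub (α τ) y z
            have : C * |τ - s| ≤ C * ε := by gcongr
            linarith
          have h9 := (hL τ).norm_sub_le (α τ) z
          have h10 : L * ‖α τ - z‖ ≤ L * ((1 + C) * ε) := by gcongr
          have h11 := hηv z hz τ (hsub hτ) t ht' (by
            rw [abs_lt] at hτs ⊢
            constructor <;> linarith)
          have h12 := norm_sub_le_norm_sub_add_norm_sub (v τ (α τ)) (v τ z) (v t z)
          have h13 : δ / (K + 1) = δ / (2 * (K + 1)) + δ / (2 * (K + 1)) := by field_simp; ring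
          linarith
      have e2 : (α (s + h) - (s + h) • v t z) - (α s - s • v t z)
          = -(y + h • v t z - α (s + h)) := by
        rw [hαs, add_smul]; abel
      rw [e2, norm_neg, add_sub_cancel_left, Real.norm_eq_abs] at h6
      refine h5.trans ?_
      calc K * ‖y + h • v t z - α (s + h)‖ ≤ (K + 1) * (δ / (K + 1) * |h|) := by
            gcongr
            linarith
        _ = δ * |h| := by field_simp

end Mollify

lemma hasCompactSupport_of_norm_lt {E : Type*} [NormedAddCommGroup E] [ProperSpace E] {F : E → ℝ}
    {R : ℝ} (hF0 : ∀ z, R < ‖z‖ → F z = 0) : HasCompactSupport F :=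
  HasCompactSupport.intro (isCompact_closedBall 0 R) fun z hz => hF0 z (by simpa using hz)

section WeakStar

variable {E : Type*} [NormedAddCommGroup E] [InnerProductSpace ℝ E] [FiniteDimensional ℝ E]
  [MeasurableSpace E] [BorelSpace E] {μ ν : ℝ → Measure E} {t₀ : ℝ}

lemma exists_measureReal_closedBall_le (hμ : ∀ t, IsLocallyFiniteMeasure (μ t))
    (hμc : ∀ f : E → ℝ, Continuous f → HasCompactSupport f →
      ContinuousOn (fun t => ∫ z, f z ∂(μ t)) (Icc 0 t₀)) (R : ℝ) :
    ∃ M, 0 ≤ M ∧ ∀ t ∈ Icc 0 t₀, (μ t).real (closedBall 0 R) ≤ M := by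
  let χ : ContDiffBump (0 : E) :=
    ⟨max R 0 + 1, max R 0 + 2, by positivity, by linarith⟩
  obtain ⟨M, hM⟩ := isCompact_Icc.exists_bound_of_continuousOn
    (hμc χ χ.continuous χ.hasCompactSupport)
  refine ⟨max M 0, le_max_right _ _, fun t ht => le_max_of_le_left ?_⟩
  have h1 := (le_abs_self _).trans (hM t ht)
  refine le_trans ?_ h1
  rw [← integral_indicator_one measurableSet_closedBall]
  refine integral_mono ?_ (χ.continuous.integrable_of_hasCompactSupport χ.hasCompactSupport) ?_
  · exact (integrable_indicator_iff measurableSet_closedBall).2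
      (continuousOn_const.integrableOn_compact (isCompact_closedBall _ _))
  · intro z
    by_cases hz : z ∈ closedBall (0 : E) R
    · have : z ∈ closedBall (0 : E) χ.rIn :=
        closedBall_subset_closedBall (by simp only [χ]; linarith [le_max_left R 0]) hz
      simp [indicator_of_mem hz, χ.one_of_mem_closedBall this]
    · simpa [indicator_of_notMem hz] using χ.nonneg

lemma abs_integral_le_mul_measureReal {m : Measure E} [IsLocallyFiniteMeasure m] {F : E → ℝ}
    {R δ : ℝ} (hF0 : ∀ z, R < ‖z‖ → F z = 0) (hFδ : ∀ z, |F z| ≤ δ) :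
    |∫ z, F z ∂m| ≤ δ * m.real (closedBall 0 R) := by
  rw [← setIntegral_eq_integral_of_forall_compl_eq_zero (s := closedBall 0 R)
    fun z hz => hF0 z (by simpa using hz)]
  exact norm_setIntegral_le_of_norm_le_const (isCompact_closedBall _ _).measure_lt_top
    fun z _ => (Real.norm_eq_abs _).trans_le (hFδ z)

lemma integrable_slice {m : Measure E} [IsLocallyFiniteMeasure m] {F : ℝ × E → ℝ} {R : ℝ}
    (hF : ContinuousOn F (Icc 0 t₀ ×ˢ univ)) (hF0 : ∀ t z, R < ‖z‖ → F (t, z) = 0)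
    {t : ℝ} (ht : t ∈ Icc 0 t₀) : Integrable (fun z => F (t, z)) m :=
  (hF.comp_continuous (by fun_prop) fun z => ⟨ht, mem_univ z⟩ :
    Continuous fun z => F (t, z)).integrable_of_hasCompactSupport
      (hasCompactSupport_of_norm_lt (hF0 t))

lemma continuousOn_integral_slice (hμ : ∀ t, IsLocallyFiniteMeasure (μ t))
    (hμc : ∀ f : E → ℝ, Continuous f → HasCompactSupport f →
      ContinuousOn (fun t => ∫ z, f z ∂(μ t)) (Icc 0 t₀))
    {F : ℝ × E → ℝ} {R : ℝ} (hF : ContinuousOn F (Icc 0 t₀ ×ˢ univ))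
    (hF0 : ∀ t z, R < ‖z‖ → F (t, z) = 0) :
    ContinuousOn (fun t => ∫ z, F (t, z) ∂(μ t)) (Icc 0 t₀) := by
  obtain ⟨M, hM0, hM⟩ := exists_measureReal_closedBall_le hμ hμc R
  intro t ht
  have hFt : Continuous fun z => F (t, z) :=
    hF.comp_continuous (by fun_prop) fun z => ⟨ht, mem_univ z⟩
  have h1 := hμc _ hFt (hasCompactSupport_of_norm_lt (hF0 t)) t ht
  rw [Metric.continuousWithinAt_iff'] at h1 ⊢
  intro δ hδ
  have hunif := (isCompact_Icc.prod (isCompact_closedBall (0 : E) R)).uniformContinuousOn_of_continuous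
    (hF.mono (prod_mono_right (subset_univ _)))
  obtain ⟨η, hη, h⟩ := Metric.uniformContinuousOn_iff.1 hunif (δ / (2 * (M + 1))) (by positivity)
  filter_upwards [h1 (δ / 2) (half_pos hδ), self_mem_nhdsWithin,
    mem_nhdsWithin_of_mem_nhds (ball_mem_nhds t hη)] with s hs hsI hsη
  have h2 : |∫ z, (F (s, z) - F (t, z)) ∂(μ s)| ≤ δ / (2 * (M + 1)) * (μ s).real (closedBall 0 R) := by
    refine abs_integral_le_mul_measureReal (fun z hz => by simp [hF0 _ z hz]) fun z => ?_
    by_cases hz : R < ‖z‖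
    · simp only [hF0 _ z hz, sub_zero, abs_zero]
      positivity
    · refine (h (s, z) ⟨hsI, by simpa using hz⟩ (t, z) ⟨ht, by simpa using hz⟩ ?_).le
      rw [mem_ball] at hsη
      simpa [Prod.dist_eq, hη] using hsη
  rw [integral_sub (integrable_slice hF hF0 hsI) (integrable_slice hF hF0 ht)] at h2
  have h3 : δ / (2 * (M + 1)) * (μ s).real (closedBall 0 R) ≤ δ / (2 * (M + 1)) * (M + 1) := by
    gcongr
    linarith [hM s hsI]
  have h4 : δ / (2 * (M + 1)) * (M + 1) = δ / 2 := by field_simp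
  rw [Real.dist_eq] at hs ⊢
  have := abs_sub_le (∫ z, F (s, z) ∂(μ s)) (∫ z, F (t, z) ∂(μ s)) (∫ z, F (t, z) ∂(μ t))
  linarith

/-- Locally finite measures are determined by integrals of compactly supported Lipschitz
functions. -/
lemma ext_of_forall_integral_lipschitz_eq {m n : Measure E} [IsLocallyFiniteMeasure m]
    [IsLocallyFiniteMeasure n]
    (h : ∀ (f : E → ℝ) (K : ℝ≥0), LipschitzWith K f → HasCompactSupport f →
      ∫ z, f z ∂m = ∫ z, f z ∂n) : m = n := by
  refine Measure.OuterRegular.ext_isOpen fun U hU => ?_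
  rw [hU.measure_eq_iSup_isCompact, hU.measure_eq_iSup_isCompact]
  refine iSup_congr fun K => iSup_congr fun _ => iSup_congr fun hK => ?_
  have hpos : ∀ n : ℕ, (0 : ℝ) < 1 / (n + 1) := fun n => Nat.one_div_pos_of_nat
  let f : ℕ → E → ℝ := fun n z => thickenedIndicator (hpos n) K z
  have hfK : ∀ n z, z ∉ cthickening 1 K → f n z = 0 := fun n z hz => by
    simp only [f, NNReal.coe_eq_zero]
    refine thickenedIndicator_zero (hpos n) K fun hz' => hz ?_
    refine thickening_subset_cthickening 1 K (thickening_mono ?_ K hz')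
    rw [div_le_one (by positivity)]
    linarith [Nat.cast_nonneg (α := ℝ) n]
  have hfs : ∀ n, HasCompactSupport (f n) := fun n =>
    HasCompactSupport.intro hK.cthickening (hfK n)
  have hflip : ∀ n : ℕ, LipschitzWith (1 / (n + 1) : ℝ).toNNReal⁻¹ (f n) := fun n =>
    lipschitzWith_thickenedIndicator (hpos n) K
  have hlim : ∀ (m : Measure E) [IsLocallyFiniteMeasure m],
      Tendsto (fun n => ∫ z, f n z ∂m) atTop (𝓝 (m.real K)) := by
    intro m _
    rw [← integral_indicator_one hK.measurableSet]
    refine tendsto_integral_of_dominated_convergence ((cthickening 1 K).indicator 1)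
      (fun n => (hflip n).continuous.aestronglyMeasurable) ?_ ?_ ?_
    · exact (integrable_indicator_iff isClosed_cthickening.measurableSet).2
        (continuousOn_const.integrableOn_compact hK.cthickening)
    · refine fun n => .of_forall fun z => ?_
      by_cases hz : z ∈ cthickening 1 K
      · rw [indicator_of_mem hz]
        simpa [f] using thickenedIndicator_le_one (hpos n) K z
      · simp [indicator_of_notMem hz, hfK n z hz]
    · refine .of_forall fun z => ?_
      have := (tendsto_pi_nhds.1 (thickenedIndicator_tendsto_indicator_closure hpos
        tendsto_one_div_add_atTop_nhds_zero_nat K)) z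
      rw [hK.isClosed.closure_eq] at this
      have := (NNReal.continuous_coe.tendsto _).comp this
      have e : ((K.indicator (fun _ => (1 : ℝ≥0)) z : ℝ≥0) : ℝ) = K.indicator 1 z := by
        by_cases hz : z ∈ K <;> simp [hz]
      rw [← e]
      exact this
  have := tendsto_nhds_unique (hlim m)
    ((hlim n).congr fun i => (h _ _ (hflip i) (hfs i)).symm)
  exact (measureReal_eq_measureReal_iff hK.measure_lt_top.ne hK.measure_lt_top.ne).1 this

end WeakStar

lemma deriv_add_inner_gradient {E : Type*} [NormedAddCommGroup E] [InnerProductSpace ℝ E]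
    [CompleteSpace E] {θ : ℝ → ℝ} (hθ : Differentiable ℝ θ)
    {g : ℝ × E → ℝ} (hg : Differentiable ℝ g) (t : ℝ) (z w : E) :
    deriv (fun s => θ s * g (s, z)) t + ⟪w, gradient (fun y => θ t * g (t, y)) z⟫
      = deriv θ t * g (t, z) + θ t * fderiv ℝ g (t, z) (1, w) := by
  have hgf := (hg (t, z)).hasFDerivAt
  have h1 : HasDerivAt (fun s => g (s, z)) (fderiv ℝ g (t, z) (1, 0)) t :=
    hgf.comp_hasDerivAt t ((hasDerivAt_id t).prodMk (hasDerivAt_const t z))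
  have h2 : HasFDerivAt (fun y => θ t * g (t, y))
      (θ t • (fderiv ℝ g (t, z)).comp (.inr ℝ ℝ E)) z :=
    (hgf.comp z (hasFDerivAt_prodMk_right t z)).const_mul _
  have h3 : HasDerivAt (fun s => θ s * g (s, z))
      (deriv θ t * g (t, z) + θ t * fderiv ℝ g (t, z) (1, 0)) t := (hθ t).hasDerivAt.mul h1
  rw [h3.deriv, real_inner_comm, gradient, h2.fderiv,
    InnerProductSpace.toDual_symm_apply]
  have : ((1 : ℝ), w) = (1, 0) + (0, w) := by simp
  rw [this, map_add]
  simp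
  ring

section Transport

variable {E : Type*} [NormedAddCommGroup E] [InnerProductSpace ℝ E] [FiniteDimensional ℝ E]
  [MeasurableSpace E] [BorelSpace E] {μ ν : ℝ → Measure E} {t₀ : ℝ} {v : ℝ → E → E}

/-- `μ` is a distributional solution on `[0, t₀)` of the transport equation with velocity `v`. -/
def IsTransportSolution (v : ℝ → E → E) (t₀ : ℝ) (μ : ℝ → Measure E) : Prop :=
  ∀ φ : ℝ × E → ℝ, ContDiff ℝ 1 φ → HasCompactSupport φ → (∀ z, ∀ t, t₀ ≤ t → φ (t, z) = 0) →
    (∫ t in Ioc (0 : ℝ) t₀,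
        ∫ z, (deriv (fun s => φ (s, z)) t + ⟪v t z, gradient (fun w => φ (t, w)) z⟫) ∂(μ t))
      + (∫ z, φ (0, z) ∂(μ 0)) = 0

/-- Functions that are limits of almost-solutions of the dual transport equation may be used
as test functions, multiplied by a cutoff in time. -/
lemma IsTransportSolution.integral_deriv_mul_eq_zero (ht₀ : 0 < t₀)
    (hsol : IsTransportSolution v t₀ μ)
    (hv : Continuous fun p : ℝ × E => v p.1 p.2)
    (hμ : ∀ t, IsLocallyFiniteMeasure (μ t))
    (hμc : ∀ f : E → ℝ, Continuous f → HasCompactSupport f →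
      ContinuousOn (fun t => ∫ z, f z ∂(μ t)) (Icc 0 t₀))
    {f : ℝ × E → ℝ} (hf : Continuous f) {R : ℝ} (hfR : ∀ t z, R < ‖z‖ → f (t, z) = 0)
    (happrox : ∀ δ > 0, ∃ g : ℝ × E → ℝ, ContDiff ℝ ∞ g ∧ (∀ t z, |g (t, z) - f (t, z)| ≤ δ) ∧
      (∀ t z, R + 1 < ‖z‖ → g (t, z) = 0) ∧
      ∀ t ∈ Icc 0 t₀, ∀ z, |fderiv ℝ g (t, z) (1, v t z)| ≤ δ)
    {θ : ℝ → ℝ} (hθ : ContDiff ℝ 1 θ) (hθs : HasCompactSupport θ) (hθ0 : ∀ t, t₀ ≤ t → θ t = 0) :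
    (∫ t in Ioc 0 t₀, deriv θ t * ∫ z, f (t, z) ∂(μ t)) + θ 0 * ∫ z, f (0, z) ∂(μ 0) = 0 := by
  obtain ⟨M, hM0, hM⟩ := exists_measureReal_closedBall_le hμ hμc (R + 1)
  have hθ' : Continuous (deriv θ) := hθ.continuous_deriv le_rfl
  obtain ⟨S, hS⟩ := hθs.exists_bound_of_continuous hθ.continuous
  obtain ⟨S', hS'⟩ := hθs.deriv.exists_bound_of_continuous hθ'
  have hS0 : 0 ≤ S := (norm_nonneg _).trans (hS 0)
  have hS0' : 0 ≤ S' := (norm_nonneg _).trans (hS' 0)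
  have h00 : (0 : ℝ) ∈ Icc 0 t₀ := ⟨le_rfl, ht₀.le⟩
  have hfR' : ∀ t z, R + 1 < ‖z‖ → f (t, z) = 0 := fun t z hz => hfR t z (by linarith)
  set A : ℝ → ℝ := fun t => ∫ z, f (t, z) ∂(μ t) with hA
  have hAc : ContinuousOn A (Icc 0 t₀) := continuousOn_integral_slice hμ hμc hf.continuousOn hfR
  set I := (∫ t in Ioc 0 t₀, deriv θ t * A t) + θ 0 * A 0 with hI
  have hbound : ∀ δ > 0, |I| ≤ (S' * t₀ + S * t₀ + S) * M * δ := by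
    intro δ hδ
    obtain ⟨g, hgs, hgf, hgR, hgd⟩ := happrox δ hδ
    have hgd' : Continuous (fderiv ℝ g) := hgs.continuous_fderiv (by simp)
    let D : ℝ × E → ℝ := fun p => fderiv ℝ g p (1, v p.1 p.2)
    have hDc : Continuous D := hgd'.clm_apply (by fun_prop)
    have hDR : ∀ t z, R + 1 < ‖z‖ → D (t, z) = 0 := by
      intro t z hz
      have : g =ᶠ[𝓝 (t, z)] fun _ => 0 := by
        have : ∀ᶠ p : ℝ × E in 𝓝 (t, z), R + 1 < ‖p.2‖ :=
          (by fun_prop : Continuous fun p : ℝ × E => ‖p.2‖).continuousAt.eventually_const_lt hz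
        exact this.mono fun p hp => hgR p.1 p.2 hp
      simp only [D, this.fderiv_eq]
      simp
    set B : ℝ → ℝ := fun t => ∫ z, g (t, z) ∂(μ t) with hB
    set Q : ℝ → ℝ := fun t => ∫ z, D (t, z) ∂(μ t) with hQ
    have hBc : ContinuousOn B (Icc 0 t₀) :=
      continuousOn_integral_slice hμ hμc hgs.continuous.continuousOn hgR
    have hQc : ContinuousOn Q (Icc 0 t₀) :=
      continuousOn_integral_slice hμ hμc hDc.continuousOn hDR
    have hgi : ∀ t ∈ Icc 0 t₀, Integrable (fun z => g (t, z)) (μ t) := fun t ht =>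
      integrable_slice hgs.continuous.continuousOn hgR ht
    have hDi : ∀ t ∈ Icc 0 t₀, Integrable (fun z => D (t, z)) (μ t) := fun t ht =>
      integrable_slice hDc.continuousOn hDR ht
    have hfi : ∀ t ∈ Icc 0 t₀, Integrable (fun z => f (t, z)) (μ t) := fun t ht =>
      integrable_slice hf.continuousOn hfR ht
    have hAB : ∀ t ∈ Icc 0 t₀, |A t - B t| ≤ δ * M := by
      intro t ht
      rw [abs_sub_comm, hA, hB, ← integral_sub (hgi t ht) (hfi t ht)]
      refine (abs_integral_le_mul_measureReal (R := R + 1) (fun z hz => ?_) (hgf t)).trans ?_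
      · simp [hgR t z hz, hfR' t z hz]
      · gcongr
        exact hM t ht
    have hQb : ∀ t ∈ Icc 0 t₀, |Q t| ≤ δ * M := by
      intro t ht
      refine (abs_integral_le_mul_measureReal (hDR t) (hgd t ht)).trans ?_
      gcongr
      exact hM t ht
    have hid := hsol (fun p => θ p.1 * g p) ((hθ.comp contDiff_fst).mul (hgs.of_le (by simp)))
      (HasCompactSupport.intro (hθs.isCompact.prod (isCompact_closedBall 0 (R + 1))) (by
        rintro ⟨t, z⟩ hp
        rw [mem_prod, not_and_or] at hp
        rcases hp with hp | hp
        · simp [image_eq_zero_of_notMem_tsupport hp]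
        · simp [hgR t z (by simpa using hp)]))
      (fun z t ht => by simp [hθ0 t ht])
    have hinner : ∀ t ∈ Ioc 0 t₀, ∫ z, (deriv (fun s => θ s * g (s, z)) t
        + ⟪v t z, gradient (fun w => θ t * g (t, w)) z⟫) ∂(μ t)
        = deriv θ t * B t + θ t * Q t := by
      intro t ht
      have ht' := Ioc_subset_Icc_self ht
      simp only [deriv_add_inner_gradient (hθ.differentiable one_ne_zero)
        (hgs.differentiable (by simp))]
      rw [integral_add ((hgi t ht').const_mul _) ((hDi t ht').const_mul _),
        integral_const_mul, integral_const_mul]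
    rw [setIntegral_congr_fun measurableSet_Ioc hinner] at hid
    simp only [integral_const_mul] at hid
    have hint : ∀ {F : ℝ → ℝ}, ContinuousOn F (Icc 0 t₀) → IntegrableOn F (Ioc 0 t₀) := fun hF =>
      (hF.integrableOn_compact isCompact_Icc).mono_set Ioc_subset_Icc_self
    have e : I = (∫ t in Ioc 0 t₀, (deriv θ t * (A t - B t) - θ t * Q t)) + θ 0 * (A 0 - B 0) := by
      have e1 : ∀ t, deriv θ t * (A t - B t) - θ t * Q t
          = deriv θ t * A t - (deriv θ t * B t + θ t * Q t) := fun t => by ring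
      simp only [e1]
      rw [integral_sub (f := fun t => deriv θ t * A t)
        (g := fun t => deriv θ t * B t + θ t * Q t) (hint (hθ'.continuousOn.mul hAc))
        (hint ((hθ'.continuousOn.mul hBc).add (hθ.continuous.continuousOn.mul hQc)))]
      linarith
    have h1 : |∫ t in Ioc 0 t₀, (deriv θ t * (A t - B t) - θ t * Q t)|
        ≤ (S' * (δ * M) + S * (δ * M)) * volume.real (Ioc 0 t₀) := by
      rw [← Real.norm_eq_abs]
      refine norm_setIntegral_le_of_norm_le_const measure_Ioc_lt_top fun t ht => ?_
      have ht' := Ioc_subset_Icc_self ht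
      refine (norm_sub_le _ _).trans ?_
      rw [norm_mul, norm_mul]
      gcongr
      · exact hS' t
      · exact hAB t ht'
      · exact hS t
      · exact hQb t ht'
    rw [Real.volume_real_Ioc_of_le ht₀.le, sub_zero] at h1
    have h2 : |θ 0 * (A 0 - B 0)| ≤ S * (δ * M) := by
      rw [abs_mul]
      gcongr
      · exact hS 0
      · exact hAB 0 h00
    rw [e]
    refine (abs_add_le _ _).trans ((add_le_add h1 h2).trans_eq ?_)
    ring
  have hlim : Tendsto (fun δ : ℝ => (S' * t₀ + S * t₀ + S) * M * δ) (𝓝[>] 0) (𝓝 0) := by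
    have : Continuous fun δ : ℝ => (S' * t₀ + S * t₀ + S) * M * δ := by fun_prop
    simpa using (this.tendsto 0).mono_left nhdsWithin_le_nhds
  exact abs_nonpos_iff.1 (ge_of_tendsto hlim (eventually_mem_nhdsWithin.mono hbound))

/-- A continuous function on `[0, t₀]` with vanishing distributional derivative and vanishing
initial value is zero. -/
lemma eqOn_zero_of_integral_deriv_mul_eq_zero (ht₀ : 0 < t₀) {G : ℝ → ℝ}
    (hG : ContinuousOn G (Icc 0 t₀))
    (h : ∀ θ : ℝ → ℝ, ContDiff ℝ 1 θ → HasCompactSupport θ → (∀ t, t₀ ≤ t → θ t = 0) →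
      ∫ t in Ioc 0 t₀, deriv θ t * G t = 0) : EqOn G 0 (Icc 0 t₀) := by
  have hloc : LocallyIntegrableOn G (Ioo 0 t₀) :=
    ((hG.integrableOn_compact isCompact_Icc).mono_set Ioo_subset_Icc_self).locallyIntegrableOn
  have hae : ∀ᵐ t, t ∈ Ioo 0 t₀ → G t = 0 := by
    refine isOpen_Ioo.ae_eq_zero_of_integral_contDiff_smul_eq_zero hloc fun g hg _ hgs => ?_
    let χ : ContDiffBump (t₀ / 2) := ⟨t₀, 2 * t₀, ht₀, by linarith⟩
    let P : ℝ → ℝ := fun t => ∫ s in t₀..t, g s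
    have hP : ∀ t, HasDerivAt P (g t) t := fun t =>
      intervalIntegral.integral_hasDerivAt_right (hg.continuous.intervalIntegrable _ _)
        (hg.continuous.stronglyMeasurableAtFilter _ _) hg.continuous.continuousAt
    have hPc : ContDiff ℝ 1 P := contDiff_one_iff_deriv.2
      ⟨fun t => (hP t).differentiableAt, by
        rw [funext fun t => (hP t).deriv]; exact hg.continuous⟩
    have hg0 : ∀ t, t ∉ Ioo 0 t₀ → g t = 0 := fun t ht =>
      image_eq_zero_of_notMem_tsupport fun h => ht (hgs h)
    have hP0 : ∀ t, t₀ ≤ t → P t = 0 := fun t ht =>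
      intervalIntegral.integral_zero_ae (.of_forall fun s hs => hg0 s fun hs' => by
        rw [uIoc_of_le ht] at hs
        exact hs'.2.not_gt hs.1)
    have key := h (fun t => χ t * P t) (χ.contDiff.mul hPc) χ.hasCompactSupport.mul_right
      fun t ht => by simp [hP0 t ht]
    rw [← key, ← setIntegral_eq_integral_of_forall_compl_eq_zero (s := Ioc 0 t₀)
      fun t ht => by simp [hg0 t fun h' => ht (Ioo_subset_Ioc_self h')]]
    refine setIntegral_congr_fun measurableSet_Ioc fun t ht => ?_
    have hχ : (fun s => χ s * P s) =ᶠ[𝓝 t] P := by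
      have : t ∈ ball (t₀ / 2) χ.rIn := by
        simp only [χ, mem_ball, Real.dist_eq, abs_lt]
        constructor <;> linarith [ht.1, ht.2]
      filter_upwards [χ.eventuallyEq_one_of_mem_ball this] with s hs
      simp [hs]
    simp only [smul_eq_mul, hχ.deriv_eq, (hP t).deriv]
  refine Measure.eqOn_Icc_of_ae_eq volume ht₀.ne ?_ hG continuousOn_const
  rw [← restrict_Ioo_eq_restrict_Icc]
  exact (ae_restrict_iff' measurableSet_Ioo).2 hae

/-- Uniqueness for the transport equation with a bounded, continuous velocity field which is
Lipschitz in space. -/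
lemma IsTransportSolution.unique (ht₀ : 0 < t₀) {C : ℝ} {L : ℝ≥0}
    (hv : Continuous fun p : ℝ × E => v p.1 p.2)
    (hC : ∀ t z, ‖v t z‖ ≤ C) (hL : ∀ t, LipschitzWith L (v t))
    (hμ : ∀ t, IsLocallyFiniteMeasure (μ t)) (hν : ∀ t, IsLocallyFiniteMeasure (ν t))
    (hμc : ∀ f : E → ℝ, Continuous f → HasCompactSupport f →
      ContinuousOn (fun t => ∫ z, f z ∂(μ t)) (Icc 0 t₀))
    (hνc : ∀ f : E → ℝ, Continuous f → HasCompactSupport f →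
      ContinuousOn (fun t => ∫ z, f z ∂(ν t)) (Icc 0 t₀))
    (h0 : μ 0 = ν 0) (hμs : IsTransportSolution v t₀ μ) (hνs : IsTransportSolution v t₀ ν)
    {T : ℝ} (hT : T ∈ Icc 0 t₀) : μ T = ν T := by
  refine ext_of_forall_integral_lipschitz_eq fun ψ K hψ hψs => ?_
  have hT' : T ∈ Icc (0 - 1) (t₀ + 1) := ⟨by linarith [hT.1], by linarith [hT.2]⟩
  obtain ⟨f, R, K', hK', hfT, hfR, hfl, hft⟩ := exists_transported hv hC hL hT' hψ hψs
  have happrox := fun δ hδ => exists_contDiff_approx hv hC hL hK' hfR hfl hft (δ := δ) hδ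
  have hf : Continuous f := continuous_of_abs_sub_le hfl
  have hAc := continuousOn_integral_slice hμ hμc hf.continuousOn hfR
  have hBc := continuousOn_integral_slice hν hνc hf.continuousOn hfR
  have hint : ∀ {F : ℝ → ℝ}, ContinuousOn F (Icc 0 t₀) → IntegrableOn F (Ioc 0 t₀) := fun hF =>
    (hF.integrableOn_compact isCompact_Icc).mono_set Ioc_subset_Icc_self
  have hzero := eqOn_zero_of_integral_deriv_mul_eq_zero ht₀ (hAc.sub hBc) (fun θ hθ hθs hθ0 => by
    have h1 := hμs.integral_deriv_mul_eq_zero ht₀ hv hμ hμc hf hfR happrox hθ hθs hθ0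
    have h2 := hνs.integral_deriv_mul_eq_zero ht₀ hv hν hνc hf hfR happrox hθ hθs hθ0
    have hθ' : ContinuousOn (deriv θ) (Icc 0 t₀) := (hθ.continuous_deriv le_rfl).continuousOn
    simp only [Pi.sub_apply, mul_sub]
    rw [integral_sub (f := fun t => deriv θ t * ∫ z, f (t, z) ∂(μ t))
      (g := fun t => deriv θ t * ∫ z, f (t, z) ∂(ν t))
      (hint (hθ'.mul hAc)) (hint (hθ'.mul hBc))]
    rw [h0] at h1
    linarith) hT
  simpa [hfT, sub_eq_zero] using hzero

end Transport

/-- **Proposition 3.11 (`prop:MV`), uniqueness part for `b = 0`:**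
two weak*-continuous families of locally finite measures that solve the homogeneous
transport equation `∂_t μ + div(u μ) = 0` in the distributional sense (`u` bounded,
continuous, and Lipschitz in space uniformly in time) and have the same initial value
coincide on `[0, t₀]`. -/
theorem stmt_14 (d : ℕ) (hd : 1 ≤ d) (t₀ : ℝ) (ht₀ : 0 < t₀)
    (u : ℝ → EuclideanSpace ℝ (Fin d) → EuclideanSpace ℝ (Fin d))
    (hu_cont : ContinuousOn (fun p : ℝ × EuclideanSpace ℝ (Fin d) => u p.1 p.2)
      (Set.Icc 0 t₀ ×ˢ Set.univ))
    (hu_bdd : ∃ C : ℝ, ∀ t ∈ Set.Icc (0 : ℝ) t₀, ∀ z, ‖u t z‖ ≤ C)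
    (hu_lip : ∃ L : NNReal, ∀ t ∈ Set.Icc (0 : ℝ) t₀, LipschitzWith L (u t))
    (μ ν : ℝ → Measure (EuclideanSpace ℝ (Fin d)))
    (hμ_fin : ∀ t, IsLocallyFiniteMeasure (μ t))
    (hν_fin : ∀ t, IsLocallyFiniteMeasure (ν t))
    -- weak*-continuity of both families:
    (hμ_cont : ∀ f : EuclideanSpace ℝ (Fin d) → ℝ, Continuous f → HasCompactSupport f →
      ContinuousOn (fun t => ∫ z, f z ∂(μ t)) (Set.Icc 0 t₀))
    (hν_cont : ∀ f : EuclideanSpace ℝ (Fin d) → ℝ, Continuous f → HasCompactSupport f →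
      ContinuousOn (fun t => ∫ z, f z ∂(ν t)) (Set.Icc 0 t₀))
    -- same initial value:
    (h0 : μ 0 = ν 0)
    -- both are distributional solutions of the homogeneous transport equation:
    (hμ_sol : ∀ φ : ℝ × EuclideanSpace ℝ (Fin d) → ℝ, ContDiff ℝ 1 φ →
      HasCompactSupport φ → (∀ z, ∀ t, t₀ ≤ t → φ (t, z) = 0) →
      (∫ t in Set.Ioc (0 : ℝ) t₀,
          ∫ z, (deriv (fun s => φ (s, z)) t + ⟪u t z, gradient (fun w => φ (t, w)) z⟫)
            ∂(μ t))
        + (∫ z, φ (0, z) ∂(μ 0)) = 0)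
    (hν_sol : ∀ φ : ℝ × EuclideanSpace ℝ (Fin d) → ℝ, ContDiff ℝ 1 φ →
      HasCompactSupport φ → (∀ z, ∀ t, t₀ ≤ t → φ (t, z) = 0) →
      (∫ t in Set.Ioc (0 : ℝ) t₀,
          ∫ z, (deriv (fun s => φ (s, z)) t + ⟪u t z, gradient (fun w => φ (t, w)) z⟫)
            ∂(ν t))
        + (∫ z, φ (0, z) ∂(ν 0)) = 0) :
    ∀ t ∈ Set.Icc (0 : ℝ) t₀, μ t = ν t := by
  obtain ⟨C, hC⟩ := hu_bdd
  obtain ⟨L, hL⟩ := hu_lip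
  let v : ℝ → EuclideanSpace ℝ (Fin d) → EuclideanSpace ℝ (Fin d) :=
    fun t => u (projIcc 0 t₀ ht₀.le t)
  have hv : Continuous fun p : ℝ × EuclideanSpace ℝ (Fin d) => v p.1 p.2 :=
    hu_cont.comp_continuous (f := fun p : ℝ × EuclideanSpace ℝ (Fin d) =>
      ((projIcc 0 t₀ ht₀.le p.1 : ℝ), p.2))
      ((continuous_subtype_val.comp (continuous_projIcc.comp continuous_fst)).prodMk
        continuous_snd) fun p => ⟨Subtype.coe_prop _, mem_univ _⟩
  have hsol : ∀ {m : ℝ → Measure (EuclideanSpace ℝ (Fin d))},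
      IsTransportSolution u t₀ m → IsTransportSolution v t₀ m := by
    intro m h φ hφ hφs hφ0
    refine Eq.trans (congrArg (· + _) ?_) (h φ hφ hφs hφ0)
    refine setIntegral_congr_fun measurableSet_Ioc fun t ht => ?_
    simp only [v, projIcc_of_mem ht₀.le (Ioc_subset_Icc_self ht)]
  intro T hT
  exact IsTransportSolution.unique ht₀ hv (fun t => hC _ (Subtype.coe_prop _))
    (fun t => hL _ (Subtype.coe_prop _)) hμ_fin hν_fin hμ_cont hν_cont h0 (hsol hμ_sol)
    (hsol hν_sol) hT
end
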